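/- arXiv:1906.12005 — 5 statements merged into one kernel-verified Lean document; each statement's English description precedes it below -/
import Mathlib

section
/- Let c ≥ 1 and let p : Fin c × Fin 2 → ℝ be a joint probability mass function of a discrete random variable a ∈ {1,…,c} and a binary random variable b ∈ {0,1} (p_{ij} ≥ 0, Σ_{i,j} p_{ij} = 1). Assume the marginals p_i := p_{i0} + p_{i1} are strictly positive for every i, and that q := Σ_i p_{i1} satisfies 0 < q < 1. Then the Rényi correlation satisfies ρ_R(a,b) = √(1 − γ/(q(1−q))), where γ := inf over w ∈ ℝ^c of Σ_{i=1}^c Σ_{j∈{0,1}} p_{ij} (w_i − (j − 1/2))². -/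
open Finset

section WeightedSums

variable {ι : Type*} [Fintype ι] {m s : ι → ℝ} {q : ℝ}

/-- The weighted second moment of `s` about its mean `q`. -/
theorem sum_mul_sub_mean_sq (hm : ∑ i, m i = 1) (hs : ∑ i, m i * s i = q) :
    ∑ i, m i * (s i - q) ^ 2 = ∑ i, m i * s i ^ 2 - q ^ 2 := by
  have h : ∀ i, m i * (s i - q) ^ 2 = m i * s i ^ 2 - 2 * q * (m i * s i) + q ^ 2 * m i :=
    fun i => by ring
  simp only [h, sum_add_distrib, sum_sub_distrib, ← mul_sum, hm, hs]
  ring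

/-- The residual variance of the best predictor of a `±1/2` label with conditional mean
`s i - 1/2` is the total variance `q (1 - q)` minus the explained variance. -/
theorem isLeast_binary_squared_loss (hm0 : ∀ i, 0 ≤ m i) (hm : ∑ i, m i = 1)
    (hs : ∑ i, m i * s i = q) :
    IsLeast {r : ℝ | ∃ w : ι → ℝ, r = ∑ i,
      (m i * (1 - s i) * (w i + 1 / 2) ^ 2 + m i * s i * (w i - 1 / 2) ^ 2)}
      (q * (1 - q) - ∑ i, m i * (s i - q) ^ 2) := by
  have hval : q * (1 - q) - ∑ i, m i * (s i - q) ^ 2 = ∑ i, (m i * s i - m i * s i ^ 2) := by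
    rw [sum_mul_sub_mean_sq hm hs, sum_sub_distrib, hs]
    ring
  rw [hval]
  refine ⟨⟨fun i => s i - 1 / 2, sum_congr rfl fun i _ => by ring⟩, ?_⟩
  rintro r ⟨w, rfl⟩
  refine sum_le_sum fun i _ => ?_
  linarith [mul_nonneg (hm0 i) (sq_nonneg (w i + 1 / 2 - s i))]

/-- Against centred `f`, the correlation with a centred function `g` of a binary variable is
`g 1 - g 0` times the covariance of `f` with `s`. -/
theorem sum_binary_correlation (f : ι → ℝ) (hf : ∑ i, m i * f i = 0) (a b : ℝ) :
    ∑ i, (m i * (1 - s i) * f i * a + m i * s i * f i * b)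
      = (b - a) * ∑ i, m i * f i * (s i - q) := by
  have h : ∀ i, m i * (1 - s i) * f i * a + m i * s i * f i * b
      = (b - a) * (m i * f i * (s i - q)) + (a + (b - a) * q) * (m i * f i) := fun i => by ring
  simp only [h, sum_add_distrib, ← mul_sum, hf, mul_zero, add_zero]

/-- For a centred normalized function of a binary variable, the jump is `± 1 / √(q (1 - q))`. -/
theorem sq_jump_mul_variance {a b : ℝ} (h0 : (1 - q) * a + q * b = 0)
    (h1 : (1 - q) * a ^ 2 + q * b ^ 2 = 1) : (b - a) ^ 2 * (q * (1 - q)) = 1 := by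
  linear_combination h1 - ((1 - q) * a + q * b) * h0

/-- The maximal correlation with a binary variable is the square root of the fraction of
variance explained by the conditional means `s i`. -/
theorem sSup_binary_correlation (hm0 : ∀ i, 0 ≤ m i) (hm : ∑ i, m i = 1)
    (hs : ∑ i, m i * s i = q) (hq0 : 0 < q) (hq1 : q < 1) :
    sSup {r : ℝ | ∃ f : ι → ℝ, ∃ g : Fin 2 → ℝ,
      (∑ i, m i * f i = 0) ∧ ((1 - q) * g 0 + q * g 1 = 0) ∧
      (∑ i, m i * f i ^ 2 = 1) ∧ ((1 - q) * g 0 ^ 2 + q * g 1 ^ 2 = 1) ∧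
      r = ∑ i, (m i * (1 - s i) * f i * g 0 + m i * s i * f i * g 1)}
      = √((∑ i, m i * (s i - q) ^ 2) / (q * (1 - q))) := by
  set V := ∑ i, m i * (s i - q) ^ 2 with hV
  have hV0 : 0 ≤ V := sum_nonneg fun i _ => mul_nonneg (hm0 i) (sq_nonneg _)
  have hD : 0 < q * (1 - q) := mul_pos hq0 (sub_pos.2 hq1)
  set S := {r : ℝ | ∃ f : ι → ℝ, ∃ g : Fin 2 → ℝ,
      (∑ i, m i * f i = 0) ∧ ((1 - q) * g 0 + q * g 1 = 0) ∧
      (∑ i, m i * f i ^ 2 = 1) ∧ ((1 - q) * g 0 ^ 2 + q * g 1 ^ 2 = 1) ∧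
      r = ∑ i, (m i * (1 - s i) * f i * g 0 + m i * s i * f i * g 1)}
  have hsq : ∀ r ∈ S, r ^ 2 ≤ V / (q * (1 - q)) := by
    rintro r ⟨f, g, hf, hg, hf1, hg1, rfl⟩
    have hCS : (∑ i, m i * f i * (s i - q)) ^ 2 ≤ (∑ i, m i * f i ^ 2) * V :=
      sum_sq_le_sum_mul_sum_of_sq_le_mul _ (fun i _ => mul_nonneg (hm0 i) (sq_nonneg _))
        (fun i _ => mul_nonneg (hm0 i) (sq_nonneg _)) fun i _ => le_of_eq (by ring)
    rw [hf1, one_mul] at hCS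
    rw [sum_binary_correlation (q := q) f hf, le_div_iff₀ hD, mul_pow, mul_right_comm,
      sq_jump_mul_variance hg hg1, one_mul]
    exact hCS
  have hle : ∀ r ∈ S, r ≤ √(V / (q * (1 - q))) := fun r hr => Real.le_sqrt_of_sq_le (hsq r hr)
  rcases hV0.eq_or_lt with h | hVpos
  · have hzero : ∀ r ∈ S, r = 0 := fun r hr =>
      pow_eq_zero_iff two_ne_zero |>.1 <| le_antisymm (by simpa [← h] using hsq r hr) (sq_nonneg r)
    rw [← h, zero_div, Real.sqrt_zero]
    exact le_antisymm (Real.sSup_nonpos fun r hr => (hzero r hr).le)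
      (Real.sSup_nonneg fun r hr => (hzero r hr).ge)
  · refine IsGreatest.csSup_eq ⟨?_, hle⟩
    have hsV : √V ^ 2 = V := Real.sq_sqrt hV0
    have hsD : √(q * (1 - q)) ^ 2 = q * (1 - q) := Real.sq_sqrt hD.le
    have hV' : √V ≠ 0 := (Real.sqrt_pos.2 hVpos).ne'
    have hD' : √(q * (1 - q)) ≠ 0 := (Real.sqrt_pos.2 hD).ne'
    have hf : ∑ i, m i * ((s i - q) / √V) = 0 := by
      have h : ∀ i, m i * ((s i - q) / √V) = (m i * s i - q * m i) / √V := fun i => by ring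
      simp only [h, ← sum_div, sum_sub_distrib, ← mul_sum, hm, hs]
      simp
    refine ⟨fun i => (s i - q) / √V, ![-q / √(q * (1 - q)), (1 - q) / √(q * (1 - q))],
      hf, ?_, ?_, ?_, ?_⟩
    · simp only [Matrix.cons_val_zero, Matrix.cons_val_one]
      ring
    · simp only [div_pow, hsV, ← mul_div_assoc, ← sum_div]
      exact div_self hVpos.ne'
    · simp only [Matrix.cons_val_zero, Matrix.cons_val_one, div_pow, hsD]
      rw [← mul_div_assoc, ← mul_div_assoc, ← add_div, div_eq_one_iff_eq hD.ne']
      ring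
    · rw [sum_binary_correlation (q := q) _ hf, Real.sqrt_div hV0]
      have h : ∀ i, m i * ((s i - q) / √V) * (s i - q) = m i * (s i - q) ^ 2 / √V :=
        fun i => by ring
      simp only [h, ← sum_div, ← hV, Matrix.cons_val_zero, Matrix.cons_val_one, Real.div_sqrt]
      ring

end WeightedSums


/-- For a joint pmf `p` of a discrete variable `a ∈ {1,…,c}` and a binary
variable `b ∈ {0,1}` with strictly positive marginals `pᵢ = p_{i0} + p_{i1}` and
`q = Σᵢ p_{i1} ∈ (0,1)`, the Rényi (maximal) correlation equals `√(1 − γ/(q(1−q)))`,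
where `γ` is the infimum over `w ∈ ℝ^c` of `Σᵢ Σⱼ p_{ij} (wᵢ − (j − 1/2))²`. -/
theorem renyi_correlation_binary_formula
    (c : ℕ) (hc : 1 ≤ c) (p : Fin c × Fin 2 → ℝ)
    (hp_nonneg : ∀ i j, 0 ≤ p (i, j))
    (hp_sum : ∑ i : Fin c, ∑ j : Fin 2, p (i, j) = 1)
    (hp_pos : ∀ i : Fin c, 0 < p (i, 0) + p (i, 1))
    (q : ℝ) (hq : q = ∑ i : Fin c, p (i, 1)) (hq0 : 0 < q) (hq1 : q < 1)
    (γ : ℝ)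
    (hγ : γ = sInf {r : ℝ | ∃ w : Fin c → ℝ,
      r = ∑ i : Fin c, ∑ j : Fin 2, p (i, j) * (w i - ((j.1 : ℝ) - 1 / 2)) ^ 2}) :
    sSup {r : ℝ | ∃ f : Fin c → ℝ, ∃ g : Fin 2 → ℝ,
      (∑ i : Fin c, (p (i, 0) + p (i, 1)) * f i = 0) ∧
      ((1 - q) * g 0 + q * g 1 = 0) ∧
      (∑ i : Fin c, (p (i, 0) + p (i, 1)) * (f i) ^ 2 = 1) ∧
      ((1 - q) * (g 0) ^ 2 + q * (g 1) ^ 2 = 1) ∧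
      r = ∑ i : Fin c, ∑ j : Fin 2, p (i, j) * f i * g j}
    = Real.sqrt (1 - γ / (q * (1 - q))) := by
  have hp1 : ∀ i, p (i, 1) = (p (i, 0) + p (i, 1)) * (p (i, 1) / (p (i, 0) + p (i, 1))) :=
    fun i => (mul_div_cancel₀ _ (hp_pos i).ne').symm
  have hp0 : ∀ i, p (i, 0)
      = (p (i, 0) + p (i, 1)) * (1 - p (i, 1) / (p (i, 0) + p (i, 1))) := fun i => by
    rw [mul_sub, ← hp1 i]
    ring
  simp only [Fin.sum_univ_two] at hp_sum hγ ⊢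
  obtain ⟨m, hm⟩ : ∃ m : Fin c → ℝ, ∀ i, p (i, 0) + p (i, 1) = m i := ⟨_, fun _ => rfl⟩
  obtain ⟨s, hs⟩ : ∃ s : Fin c → ℝ, ∀ i, p (i, 1) / m i = s i := ⟨_, fun _ => rfl⟩
  simp only [hm, hs] at hp_sum hp_pos hp0 hp1 ⊢
  have hm0 : ∀ i, 0 ≤ m i := fun i => (hp_pos i).le
  have hmean : ∑ i, m i * s i = q := by
    rw [hq]
    exact sum_congr rfl fun i _ => (hp1 i).symm
  simp only [hp0, hp1] at hγ ⊢
  have hγV : γ = q * (1 - q) - ∑ i, m i * (s i - q) ^ 2 := by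
    rw [hγ, ← (isLeast_binary_squared_loss hm0 hp_sum hmean).csInf_eq]
    norm_num
  have hD : q * (1 - q) ≠ 0 := (mul_pos hq0 (sub_pos.2 hq1)).ne'
  rw [sSup_binary_correlation hm0 hp_sum hmean hq0 hq1, hγV, sub_div, div_self hD,
    sub_sub_cancel]
end

section
/- Let c ≥ 1 and let p : Fin c × Fin 2 → ℝ be a joint probability mass function with marginals p_i := p_{i0} + p_{i1} > 0 for all i and q := Σ_i p_{i1} ∈ (0,1). Then ρ_R(a,b)² = Σ_{i=1}^c (1/p_i) ( p_{i1}·√((1−q)/q) − p_{i0}·√(q/(1−q)) )². -/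
/-- A normalized function on a two-point space with weights `1 - q` and `q` is unique up to sign. -/
lemma exists_sign_of_normalized {q s t g₀ g₁ : ℝ} (hq1 : q < 1) (hst : s * t = 1)
    (hs : q * s ^ 2 = 1 - q) (ht : (1 - q) * t ^ 2 = q)
    (hmean : (1 - q) * g₀ + q * g₁ = 0) (hvar : (1 - q) * g₀ ^ 2 + q * g₁ ^ 2 = 1) :
    ∃ e : ℝ, e ^ 2 = 1 ∧ g₀ = -t * e ∧ g₁ = s * e := by
  have h₁ : g₁ = s * (t * g₁) := by linear_combination (-g₁) * hst
  have h₀ : g₀ = -t * (t * g₁) := by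
    apply mul_left_cancel₀ (sub_pos.2 hq1).ne'
    linear_combination hmean + g₁ * ht
  refine ⟨t * g₁, ?_, h₀, h₁⟩
  generalize t * g₁ = e at h₀ h₁
  subst h₀ h₁
  linear_combination hvar - e ^ 2 * hs - e ^ 2 * ht

/-- The weighted Cauchy–Schwarz inequality. -/
lemma sq_sum_mul_le_of_weight_pos {ι : Type*} [Fintype ι] {P : ι → ℝ} (hP : ∀ i, 0 < P i)
    (w f : ι → ℝ) (hf : ∑ i, P i * f i ^ 2 = 1) :
    (∑ i, w i * f i) ^ 2 ≤ ∑ i, 1 / P i * w i ^ 2 := by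
  have h := Finset.sum_sq_le_sum_mul_sum_of_sq_le_mul Finset.univ
    (r := fun i => w i * f i) (f := fun i => 1 / P i * w i ^ 2) (g := fun i => P i * f i ^ 2)
    (fun i _ => mul_nonneg (one_div_pos.2 (hP i)).le (sq_nonneg _))
    (fun i _ => mul_nonneg (hP i).le (sq_nonneg _))
    (fun i _ => le_of_eq (by have := (hP i).ne'; field_simp))
  rwa [hf, mul_one] at h

/-- The extremal function in the weighted Cauchy–Schwarz inequality. -/
lemma exists_normalized_sum_mul_eq_sqrt {ι : Type*} [Fintype ι] {P : ι → ℝ}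
    (hP : ∀ i, 0 < P i) {w : ι → ℝ} (hw : ∑ i, w i = 0) (hD : 0 < ∑ i, 1 / P i * w i ^ 2) :
    ∃ f : ι → ℝ, ∑ i, P i * f i = 0 ∧ ∑ i, P i * f i ^ 2 = 1 ∧
      ∑ i, w i * f i = √(∑ i, 1 / P i * w i ^ 2) := by
  set D := ∑ i, 1 / P i * w i ^ 2 with hDdef
  have hR : √D ≠ 0 := (Real.sqrt_pos.2 hD).ne'
  have hR2 : √D ^ 2 = D := Real.sq_sqrt hD.le
  refine ⟨fun i => w i / P i / √D, ?_, ?_, ?_⟩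
  · calc ∑ i, P i * (w i / P i / √D) = ∑ i, w i / √D :=
          Finset.sum_congr rfl fun i _ => by have := (hP i).ne'; field_simp
      _ = 0 := by rw [← Finset.sum_div, hw, zero_div]
  · calc ∑ i, P i * (w i / P i / √D) ^ 2 = ∑ i, 1 / P i * w i ^ 2 / √D ^ 2 :=
          Finset.sum_congr rfl fun i _ => by have := (hP i).ne'; field_simp
      _ = 1 := by rw [← Finset.sum_div, ← hDdef, hR2, div_self hD.ne']
  · calc ∑ i, w i * (w i / P i / √D) = ∑ i, 1 / P i * w i ^ 2 / √D :=
          Finset.sum_congr rfl fun i _ => by have := (hP i).ne'; field_simp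
      _ = √D := by rw [← Finset.sum_div, ← hDdef, Real.div_sqrt]

/-- For a joint pmf of a discrete variable `a ∈ {1,…,c}` and a binary
variable `b` with positive marginals `pᵢ` and `q ∈ (0,1)`, the squared Rényi correlation
equals `Σᵢ (1/pᵢ)(p_{i1} √((1−q)/q) − p_{i0} √(q/(1−q)))²`. -/
theorem renyi_correlation_squared_formula
    (c : ℕ) (hc : 1 ≤ c) (p : Fin c × Fin 2 → ℝ)
    (hp_nonneg : ∀ i j, 0 ≤ p (i, j))
    (hp_sum : ∑ i : Fin c, ∑ j : Fin 2, p (i, j) = 1)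
    (hp_pos : ∀ i : Fin c, 0 < p (i, 0) + p (i, 1))
    (q : ℝ) (hq : q = ∑ i : Fin c, p (i, 1)) (hq0 : 0 < q) (hq1 : q < 1) :
    (sSup {r : ℝ | ∃ f : Fin c → ℝ, ∃ g : Fin 2 → ℝ,
      (∑ i : Fin c, (p (i, 0) + p (i, 1)) * f i = 0) ∧
      ((1 - q) * g 0 + q * g 1 = 0) ∧
      (∑ i : Fin c, (p (i, 0) + p (i, 1)) * (f i) ^ 2 = 1) ∧
      ((1 - q) * (g 0) ^ 2 + q * (g 1) ^ 2 = 1) ∧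
      r = ∑ i : Fin c, ∑ j : Fin 2, p (i, j) * f i * g j}) ^ 2
    = ∑ i : Fin c, (1 / (p (i, 0) + p (i, 1))) *
        (p (i, 1) * Real.sqrt ((1 - q) / q) - p (i, 0) * Real.sqrt (q / (1 - q))) ^ 2 := by
  have hq1' : 0 < 1 - q := sub_pos.2 hq1
  have hst : √((1 - q) / q) * √(q / (1 - q)) = 1 := by
    rw [← Real.sqrt_mul (by positivity), div_mul_div_cancel₀ hq0.ne', div_self hq1'.ne',
      Real.sqrt_one]
  have hs : q * √((1 - q) / q) ^ 2 = 1 - q := by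
    rw [Real.sq_sqrt (by positivity)]; field_simp
  have ht : (1 - q) * √(q / (1 - q)) ^ 2 = q := by
    rw [Real.sq_sqrt (by positivity)]; field_simp
  generalize √((1 - q) / q) = s at *
  generalize √(q / (1 - q)) = t at *
  have hqst : q * s = (1 - q) * t := by linear_combination t * hs - q * s * hst
  have hq' : ∑ i : Fin c, p (i, 0) = 1 - q := by
    simp only [Fin.sum_univ_two, Finset.sum_add_distrib] at hp_sum
    linarith
  have hw : ∑ i : Fin c, (p (i, 1) * s - p (i, 0) * t) = 0 := by
    rw [Finset.sum_sub_distrib, ← Finset.sum_mul, ← Finset.sum_mul, ← hq, hq', hqst, sub_self]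
  have hcorr (f : Fin c → ℝ) (g : Fin 2 → ℝ) (e : ℝ) (h₀ : g 0 = -t * e) (h₁ : g 1 = s * e) :
      ∑ i : Fin c, ∑ j : Fin 2, p (i, j) * f i * g j
        = e * ∑ i, (p (i, 1) * s - p (i, 0) * t) * f i := by
    rw [Finset.mul_sum]
    refine Finset.sum_congr rfl fun i _ => ?_
    rw [Fin.sum_univ_two, h₀, h₁]
    ring
  set S := {r : ℝ | ∃ f : Fin c → ℝ, ∃ g : Fin 2 → ℝ, _}
  set D := ∑ i : Fin c, 1 / (p (i, 0) + p (i, 1)) * (p (i, 1) * s - p (i, 0) * t) ^ 2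
  have hD0 : 0 ≤ D :=
    Finset.sum_nonneg fun i _ => mul_nonneg (one_div_pos.2 (hp_pos i)).le (sq_nonneg _)
  have hbound : ∀ r ∈ S, r ^ 2 ≤ D := by
    rintro r ⟨f, g, -, hg, hf, hg2, rfl⟩
    obtain ⟨e, he, h₀, h₁⟩ := exists_sign_of_normalized hq1 hst hs ht hg hg2
    rw [hcorr f g e h₀ h₁, mul_pow, he, one_mul]
    exact sq_sum_mul_le_of_weight_pos hp_pos _ f hf
  rcases hD0.eq_or_lt with h | h
  · have hzero : ∀ r ∈ S, r = 0 := fun r hr =>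
      pow_eq_zero_iff two_ne_zero |>.1 (le_antisymm (h ▸ hbound r hr) (sq_nonneg r))
    have hsup : sSup S = 0 := le_antisymm (Real.sSup_nonpos fun r hr => (hzero r hr).le)
      (Real.sSup_nonneg fun r hr => (hzero r hr).ge)
    rw [hsup, ← h, zero_pow two_ne_zero]
  · obtain ⟨f, hf, hf2, hfw⟩ := exists_normalized_sum_mul_eq_sqrt hp_pos hw h
    have hgreatest : IsGreatest S √D := by
      refine ⟨⟨f, ![-t, s], hf, ?_, hf2, ?_, ?_⟩, fun r hr => Real.le_sqrt_of_sq_le (hbound r hr)⟩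
      · simp only [Matrix.cons_val_zero, Matrix.cons_val_one]
        linear_combination hqst
      · simp only [Matrix.cons_val_zero, Matrix.cons_val_one]
        linear_combination hs + ht
      · rw [hcorr f _ 1 (by simp) (by simp), one_mul, hfw]
    rw [hgreatest.csSup_eq, Real.sq_sqrt hD0]
end

section
/- Let c ≥ 1 and let p : Fin c × Fin 2 → ℝ be a joint probability mass function with marginals p_i := p_{i0} + p_{i1} > 0 for all i and q := Σ_i p_{i1} ∈ (0,1). Then ρ_R(a,b) = 0 if and only if a and b are independent, i.e., p_{i1} = p_i · q (and hence p_{i0} = p_i · (1 − q)) for every i. -/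
/-- A correlation of two unit-variance functions under a joint pmf is at most one. -/
theorem sum_mul_mul_le_one_of_second_moments_eq_one {ι : Type*} [Fintype ι]
    {p : ι × Fin 2 → ℝ} {q : ℝ} (hp_nonneg : ∀ i j, 0 ≤ p (i, j))
    (hq : ∑ i, p (i, 1) = q) (hq' : ∑ i, p (i, 0) = 1 - q) {f : ι → ℝ} {g : Fin 2 → ℝ}
    (hf : ∑ i, (p (i, 0) + p (i, 1)) * f i ^ 2 = 1)
    (hg : (1 - q) * g 0 ^ 2 + q * g 1 ^ 2 = 1) :
    ∑ i, ∑ j : Fin 2, p (i, j) * f i * g j ≤ 1 := by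
  have hle : ∑ i, ∑ j : Fin 2, p (i, j) * f i * g j ≤
      ∑ i, ((p (i, 0) + p (i, 1)) * f i ^ 2 + p (i, 0) * g 0 ^ 2 + p (i, 1) * g 1 ^ 2) / 2 := by
    refine Finset.sum_le_sum fun i _ => ?_
    rw [Fin.sum_univ_two]
    nlinarith [mul_nonneg (hp_nonneg i 0) (sq_nonneg (f i - g 0)),
      mul_nonneg (hp_nonneg i 1) (sq_nonneg (f i - g 1))]
  rw [← Finset.sum_div, Finset.sum_add_distrib, Finset.sum_add_distrib, ← Finset.sum_mul,
    ← Finset.sum_mul, hf, hq, hq'] at hle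
  linarith

/-- Under independence, the correlation with a centred binary function vanishes. -/
theorem sum_mul_mul_eq_zero_of_independent {ι : Type*} [Fintype ι]
    {p : ι × Fin 2 → ℝ} {q : ℝ} (hind : ∀ i, p (i, 1) = (p (i, 0) + p (i, 1)) * q)
    (f : ι → ℝ) {g : Fin 2 → ℝ} (hg : (1 - q) * g 0 + q * g 1 = 0) :
    ∑ i, ∑ j : Fin 2, p (i, j) * f i * g j = 0 := by
  refine Finset.sum_eq_zero fun i _ => ?_
  rw [Fin.sum_univ_two]
  linear_combination (f i * (g 1 - g 0)) * hind i + (p (i, 0) + p (i, 1)) * f i * hg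

/-- If independence fails, some pair of standardized functions is positively correlated:
take `f` proportional to `p_{i1} / pᵢ - q`. -/
theorem exists_pos_correlation_of_not_independent {ι : Type*} [Fintype ι]
    {p : ι × Fin 2 → ℝ} {q : ℝ} (hp_pos : ∀ i, 0 < p (i, 0) + p (i, 1))
    (hq : ∑ i, p (i, 1) = q) (hq' : ∑ i, p (i, 0) = 1 - q) (hq0 : 0 < q) (hq1 : q < 1)
    (hdep : ∃ i, p (i, 1) ≠ (p (i, 0) + p (i, 1)) * q) :
    ∃ f : ι → ℝ, ∃ g : Fin 2 → ℝ,
      ∑ i, (p (i, 0) + p (i, 1)) * f i = 0 ∧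
      (1 - q) * g 0 + q * g 1 = 0 ∧
      ∑ i, (p (i, 0) + p (i, 1)) * f i ^ 2 = 1 ∧
      (1 - q) * g 0 ^ 2 + q * g 1 ^ 2 = 1 ∧
      0 < ∑ i, ∑ j : Fin 2, p (i, j) * f i * g j := by
  obtain ⟨k, hk⟩ := hdep
  set h : ι → ℝ := fun i => p (i, 1) / (p (i, 0) + p (i, 1)) - q with h_def
  have hmul (i : ι) : (p (i, 0) + p (i, 1)) * h i =
      p (i, 1) - (p (i, 0) + p (i, 1)) * q := by
    have := (hp_pos i).ne'
    simp only [h_def]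
    field_simp
  have hmean : ∑ i, (p (i, 0) + p (i, 1)) * h i = 0 := by
    simp only [hmul]
    rw [Finset.sum_sub_distrib, ← Finset.sum_mul, Finset.sum_add_distrib, hq, hq']
    ring
  set V := ∑ i, (p (i, 0) + p (i, 1)) * h i ^ 2 with hV
  have hV_pos : 0 < V := by
    have hhk : h k ≠ 0 := by
      intro h0
      have hmulk := hmul k
      rw [h0, mul_zero] at hmulk
      exact hk (sub_eq_zero.1 hmulk.symm)
    exact Finset.sum_pos' (fun i _ => mul_nonneg (hp_pos i).le (sq_nonneg _))
      ⟨k, Finset.mem_univ k, mul_pos (hp_pos k) (by positivity)⟩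
  have hs : √V ^ 2 = V := Real.sq_sqrt hV_pos.le
  have hs_pos : 0 < √V := Real.sqrt_pos.2 hV_pos
  have hqq : 0 < q * (1 - q) := mul_pos hq0 (sub_pos.2 hq1)
  set t := √(q * (1 - q))
  have ht : t ^ 2 = q * (1 - q) := Real.sq_sqrt hqq.le
  have ht_pos : 0 < t := Real.sqrt_pos.2 hqq
  refine ⟨fun i => h i / √V, ![-q / t, (1 - q) / t], ?_, ?_, ?_, ?_, ?_⟩
  · simp only [← mul_div_assoc]
    rw [← Finset.sum_div, hmean, zero_div]
  · simp only [Matrix.cons_val_zero, Matrix.cons_val_one]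
    ring
  · simp only [div_pow, hs, ← mul_div_assoc]
    rw [← Finset.sum_div, ← hV, div_self hV_pos.ne']
  · simp only [Matrix.cons_val_zero, Matrix.cons_val_one, div_pow]
    rw [ht]
    have : 1 - q ≠ 0 := (sub_pos.2 hq1).ne'
    field_simp
    ring
  · have hcorr : ∑ i, ∑ j : Fin 2, p (i, j) * (h i / √V) * ![-q / t, (1 - q) / t] j =
        V / (√V * t) := by
      rw [hV, Finset.sum_div]
      refine Finset.sum_congr rfl fun i _ => ?_
      rw [Fin.sum_univ_two]
      simp only [Matrix.cons_val_zero, Matrix.cons_val_one]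
      rw [← hV]
      field_simp
      linear_combination -h i * hmul i
    rw [hcorr]
    positivity

/-- For a joint pmf of a discrete variable and a binary variable with
positive marginals `pᵢ = p_{i0} + p_{i1}` and `q = Σᵢ p_{i1} ∈ (0,1)`, the Rényi
correlation is zero iff the variables are independent, i.e. `p_{i1} = pᵢ q` for all `i`. -/
theorem renyi_correlation_eq_zero_iff_independent
    (c : ℕ) (hc : 1 ≤ c) (p : Fin c × Fin 2 → ℝ)
    (hp_nonneg : ∀ i j, 0 ≤ p (i, j))
    (hp_sum : ∑ i : Fin c, ∑ j : Fin 2, p (i, j) = 1)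
    (hp_pos : ∀ i : Fin c, 0 < p (i, 0) + p (i, 1))
    (q : ℝ) (hq : q = ∑ i : Fin c, p (i, 1)) (hq0 : 0 < q) (hq1 : q < 1) :
    sSup {r : ℝ | ∃ f : Fin c → ℝ, ∃ g : Fin 2 → ℝ,
      (∑ i : Fin c, (p (i, 0) + p (i, 1)) * f i = 0) ∧
      ((1 - q) * g 0 + q * g 1 = 0) ∧
      (∑ i : Fin c, (p (i, 0) + p (i, 1)) * (f i) ^ 2 = 1) ∧
      ((1 - q) * (g 0) ^ 2 + q * (g 1) ^ 2 = 1) ∧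
      r = ∑ i : Fin c, ∑ j : Fin 2, p (i, j) * f i * g j} = 0
    ↔ ∀ i : Fin c, p (i, 1) = (p (i, 0) + p (i, 1)) * q := by
  have hq_sum : ∑ i, p (i, 1) = q := hq.symm
  have hq'_sum : ∑ i, p (i, 0) = 1 - q := by
    simp only [Fin.sum_univ_two, Finset.sum_add_distrib] at hp_sum
    linarith
  constructor
  · intro hsup
    by_contra! hdep
    obtain ⟨f, g, hf, hg, hf2, hg2, hpos⟩ :=
      exists_pos_correlation_of_not_independent hp_pos hq_sum hq'_sum hq0 hq1 hdep
    refine hpos.not_ge (hsup ▸ le_csSup ⟨1, ?_⟩ ⟨f, g, hf, hg, hf2, hg2, rfl⟩)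
    rintro r ⟨f, g, -, -, hf2, hg2, rfl⟩
    exact sum_mul_mul_le_one_of_second_moments_eq_one hp_nonneg hq_sum hq'_sum hf2 hg2
  · intro hind
    have hzero : ∀ r ∈ {r : ℝ | ∃ f : Fin c → ℝ, ∃ g : Fin 2 → ℝ,
        (∑ i : Fin c, (p (i, 0) + p (i, 1)) * f i = 0) ∧
        ((1 - q) * g 0 + q * g 1 = 0) ∧
        (∑ i : Fin c, (p (i, 0) + p (i, 1)) * (f i) ^ 2 = 1) ∧
        ((1 - q) * (g 0) ^ 2 + q * (g 1) ^ 2 = 1) ∧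
        r = ∑ i : Fin c, ∑ j : Fin 2, p (i, j) * f i * g j}, r = 0 := by
      rintro r ⟨f, g, -, hg, -, -, rfl⟩
      exact sum_mul_mul_eq_zero_of_independent hind f hg
    exact le_antisymm (Real.sSup_nonpos fun r hr => (hzero r hr).le)
      (Real.sSup_nonneg fun r hr => (hzero r hr).ge)
end

section
/- Let c, d ≥ 1 and let p : Fin c × Fin d → ℝ be a joint probability mass function with strictly positive marginals p_i := Σ_j p_{ij} > 0 and q_j := Σ_i p_{ij} > 0. Define Q ∈ ℝ^{c×d} by Q_{ij} = p_{ij}/√(p_i q_j) and v₁ ∈ ℝ^d by (v₁)_j = √(q_j). Then the Rényi correlation satisfies ρ_R(a,b) = sup { ‖Q v‖ : v ∈ ℝ^d, ‖v‖ ≤ 1, ⟨v, v₁⟩ = 0 }; that is, ρ_R(a,b) equals the second largest singular value of Q. -/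
/-- The squared norm of `Q v` is at most the squared Frobenius norm of `Q` times that of `v`. -/
theorem sum_mulVec_sq_le {c d : ℕ} (Q : Matrix (Fin c) (Fin d) ℝ) (v : Fin d → ℝ) :
    ∑ i, (Q.mulVec v i) ^ 2 ≤ (∑ i, ∑ j, (Q i j) ^ 2) * ∑ j, (v j) ^ 2 := by
  rw [Finset.sum_mul]
  exact Finset.sum_le_sum fun i _ => Finset.sum_mul_sq_le_sq_mul_sq Finset.univ (Q i) v

/-- A sum of products of a unit vector with `w` is at most the norm of `w`. -/
theorem sum_mul_le_sqrt_of_sum_sq_eq_one {c : ℕ} (u w : Fin c → ℝ) (hu : ∑ i, (u i) ^ 2 = 1) :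
    ∑ i, u i * w i ≤ Real.sqrt (∑ i, (w i) ^ 2) := by
  apply Real.le_sqrt_of_sq_le
  simpa [hu] using Finset.sum_mul_sq_le_sq_mul_sq Finset.univ u w

/-- Rescaling by `√a` and `√b` turns a bilinear form into one with matrix `Q`. -/
theorem sum_mul_eq_sum_mul_mulVec {c d : ℕ} (p : Fin c × Fin d → ℝ) (a : Fin c → ℝ)
    (b : Fin d → ℝ) (Q : Matrix (Fin c) (Fin d) ℝ)
    (hp : ∀ i j, p (i, j) = Q i j * (Real.sqrt (a i) * Real.sqrt (b j)))
    (f : Fin c → ℝ) (g : Fin d → ℝ) :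
    ∑ i, ∑ j, p (i, j) * f i * g j =
      ∑ i, (Real.sqrt (a i) * f i) * Q.mulVec (fun j => Real.sqrt (b j) * g j) i := by
  refine Finset.sum_congr rfl fun i _ => ?_
  simp only [Matrix.mulVec, dotProduct, Finset.mul_sum]
  refine Finset.sum_congr rfl fun j _ => ?_
  rw [hp]
  ring

/-- The transpose of `Q` maps `√a` to `√b` when `b` is the column marginal. -/
theorem sum_sqrt_mul_mulVec {c d : ℕ} (p : Fin c × Fin d → ℝ) (a : Fin c → ℝ)
    (b : Fin d → ℝ) (hb : ∀ j, 0 < b j) (hpb : ∀ j, ∑ i, p (i, j) = b j)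
    (Q : Matrix (Fin c) (Fin d) ℝ)
    (hp : ∀ i j, p (i, j) = Q i j * (Real.sqrt (a i) * Real.sqrt (b j))) (v : Fin d → ℝ) :
    ∑ i, Real.sqrt (a i) * Q.mulVec v i = ∑ j, v j * Real.sqrt (b j) := by
  simp only [Matrix.mulVec, dotProduct, Finset.mul_sum]
  rw [Finset.sum_comm]
  refine Finset.sum_congr rfl fun j _ => ?_
  have hj := Real.sqrt_pos.2 (hb j)
  have key : (∑ i, Q i j * Real.sqrt (a i)) = Real.sqrt (b j) := by
    apply mul_right_cancel₀ hj.ne'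
    rw [Real.mul_self_sqrt (hb j).le, ← hpb j, Finset.sum_mul]
    refine Finset.sum_congr rfl fun i _ => ?_
    rw [hpb j, hp]
    ring
  rw [← key, Finset.mul_sum]
  exact Finset.sum_congr rfl fun i _ => by ring

/-- Witsenhausen: The Rényi correlation of a joint pmf with positive
marginals equals the second largest singular value of `Q_{ij} = p_{ij}/√(pᵢ qⱼ)`, i.e.
the supremum of `‖Q v‖` over unit-ball vectors `v` orthogonal to `(v₁)ⱼ = √qⱼ`. -/
theorem renyi_correlation_eq_second_singular_value
    (c d : ℕ) (hc : 1 ≤ c) (hd : 1 ≤ d) (p : Fin c × Fin d → ℝ)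
    (hp_nonneg : ∀ i j, 0 ≤ p (i, j))
    (hp_sum : ∑ i : Fin c, ∑ j : Fin d, p (i, j) = 1)
    (hpi : ∀ i : Fin c, 0 < ∑ j : Fin d, p (i, j))
    (hqj : ∀ j : Fin d, 0 < ∑ i : Fin c, p (i, j))
    (Q : Matrix (Fin c) (Fin d) ℝ)
    (hQ : ∀ i j, Q i j = p (i, j) /
      Real.sqrt ((∑ j' : Fin d, p (i, j')) * (∑ i' : Fin c, p (i', j)))) :
    sSup {r : ℝ | ∃ f : Fin c → ℝ, ∃ g : Fin d → ℝ,
      (∑ i : Fin c, (∑ j : Fin d, p (i, j)) * f i = 0) ∧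
      (∑ j : Fin d, (∑ i : Fin c, p (i, j)) * g j = 0) ∧
      (∑ i : Fin c, (∑ j : Fin d, p (i, j)) * (f i) ^ 2 = 1) ∧
      (∑ j : Fin d, (∑ i : Fin c, p (i, j)) * (g j) ^ 2 = 1) ∧
      r = ∑ i : Fin c, ∑ j : Fin d, p (i, j) * f i * g j}
    = sSup {r : ℝ | ∃ v : Fin d → ℝ,
      (∑ j : Fin d, (v j) ^ 2 ≤ 1) ∧
      (∑ j : Fin d, v j * Real.sqrt (∑ i : Fin c, p (i, j)) = 0) ∧
      r = Real.sqrt (∑ i : Fin c, (Q.mulVec v i) ^ 2)} := by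
  set a : Fin c → ℝ := fun i => ∑ j, p (i, j)
  set b : Fin d → ℝ := fun j => ∑ i, p (i, j)
  have hap : ∀ i, 0 < a i := hpi
  have hbp : ∀ j, 0 < b j := hqj
  have hsa : ∀ i, 0 < Real.sqrt (a i) := fun i => Real.sqrt_pos.2 (hap i)
  have hsb : ∀ j, 0 < Real.sqrt (b j) := fun j => Real.sqrt_pos.2 (hbp j)
  have hp : ∀ i j, p (i, j) = Q i j * (Real.sqrt (a i) * Real.sqrt (b j)) := by
    intro i j
    rw [hQ, ← Real.sqrt_mul (hap i).le]
    exact (div_mul_cancel₀ _ (Real.sqrt_pos.2 (mul_pos (hap i) (hbp j))).ne').symm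
  have hasq : ∀ i x, (Real.sqrt (a i) * x) ^ 2 = a i * x ^ 2 := fun i x => by
    rw [mul_pow, Real.sq_sqrt (hap i).le]
  have hbsq : ∀ j x, (Real.sqrt (b j) * x) ^ 2 = b j * x ^ 2 := fun j x => by
    rw [mul_pow, Real.sq_sqrt (hbp j).le]
  change sSup {r : ℝ | ∃ f : Fin c → ℝ, ∃ g : Fin d → ℝ,
      (∑ i, a i * f i = 0) ∧ (∑ j, b j * g j = 0) ∧
      (∑ i, a i * (f i) ^ 2 = 1) ∧ (∑ j, b j * (g j) ^ 2 = 1) ∧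
      r = ∑ i, ∑ j, p (i, j) * f i * g j} = sSup {r : ℝ | ∃ v : Fin d → ℝ,
      (∑ j, (v j) ^ 2 ≤ 1) ∧ (∑ j, v j * Real.sqrt (b j) = 0) ∧
      r = Real.sqrt (∑ i, (Q.mulVec v i) ^ 2)}
  set S := {r : ℝ | ∃ f : Fin c → ℝ, ∃ g : Fin d → ℝ,
      (∑ i, a i * f i = 0) ∧ (∑ j, b j * g j = 0) ∧
      (∑ i, a i * (f i) ^ 2 = 1) ∧ (∑ j, b j * (g j) ^ 2 = 1) ∧
      r = ∑ i, ∑ j, p (i, j) * f i * g j}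
  set T := {r : ℝ | ∃ v : Fin d → ℝ,
      (∑ j, (v j) ^ 2 ≤ 1) ∧ (∑ j, v j * Real.sqrt (b j) = 0) ∧
      r = Real.sqrt (∑ i, (Q.mulVec v i) ^ 2)}
  have hTb : BddAbove T := by
    refine ⟨Real.sqrt (∑ i, ∑ j, (Q i j) ^ 2), ?_⟩
    rintro r ⟨v, hv, -, rfl⟩
    refine Real.sqrt_le_sqrt ((sum_mulVec_sq_le Q v).trans ?_)
    exact mul_le_of_le_one_right
      (Finset.sum_nonneg fun i _ => Finset.sum_nonneg fun j _ => sq_nonneg _) hv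
  have hST : ∀ r ∈ S, r ≤ sSup T := by
    rintro r ⟨f, g, -, hg0, hf1, hg1, rfl⟩
    rw [sum_mul_eq_sum_mul_mulVec p a b Q hp]
    refine (sum_mul_le_sqrt_of_sum_sq_eq_one _ _ ?_).trans
      (le_csSup hTb ⟨fun j => Real.sqrt (b j) * g j, ?_, ?_, rfl⟩)
    · simp only [hasq, hf1]
    · simp only [hbsq, hg1, le_refl]
    · rw [← hg0]
      refine Finset.sum_congr rfl fun j _ => ?_
      rw [mul_right_comm, Real.mul_self_sqrt (hbp j).le]
  have hSb : BddAbove S := ⟨sSup T, hST⟩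
  have hS0 : 0 ≤ sSup S := by
    rcases S.eq_empty_or_nonempty with h | ⟨r, hr⟩
    · rw [h, Real.sSup_empty]
    · have hneg : -r ∈ S := by
        obtain ⟨f, g, hf0, hg0, hf1, hg1, rfl⟩ := hr
        exact ⟨fun i => -f i, g, by simp [hf0], hg0, by simpa using hf1, hg1, by simp⟩
      linarith [le_csSup hSb hr, le_csSup hSb hneg]
  apply le_antisymm
  · refine Real.sSup_le hST (Real.sSup_nonneg ?_)
    rintro r ⟨v, -, -, rfl⟩
    exact Real.sqrt_nonneg _
  · refine Real.sSup_le ?_ hS0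
    rintro r ⟨v, hv, hv0, rfl⟩
    set N := Real.sqrt (∑ i, (Q.mulVec v i) ^ 2)
    set n := Real.sqrt (∑ j, (v j) ^ 2)
    have hNsq : N ^ 2 = ∑ i, (Q.mulVec v i) ^ 2 :=
      Real.sq_sqrt (Finset.sum_nonneg fun i _ => sq_nonneg _)
    have hnsq : n ^ 2 = ∑ j, (v j) ^ 2 :=
      Real.sq_sqrt (Finset.sum_nonneg fun j _ => sq_nonneg _)
    have hN0 : 0 ≤ N := Real.sqrt_nonneg _
    rcases hN0.eq_or_lt with h0 | hNpos
    · rwa [← h0]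
    have hnpos : 0 < n := by
      refine lt_of_le_of_ne (Real.sqrt_nonneg _) fun h => ?_
      have := sum_mulVec_sq_le Q v
      rw [← hNsq, ← hnsq, ← h] at this
      nlinarith
    have hn1 : n ≤ 1 := Real.sqrt_le_one.2 hv
    have hf : ∀ i, Real.sqrt (a i) * (Q.mulVec v i / N / Real.sqrt (a i)) = Q.mulVec v i / N :=
      fun i => mul_div_cancel₀ _ (hsa i).ne'
    have hg : ∀ j, Real.sqrt (b j) * (v j / n / Real.sqrt (b j)) = v j / n :=
      fun j => mul_div_cancel₀ _ (hsb j).ne'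
    have hmem : N / n ∈ S := by
      refine ⟨fun i => Q.mulVec v i / N / Real.sqrt (a i), fun j => v j / n / Real.sqrt (b j),
        ?_, ?_, ?_, ?_, ?_⟩
      · calc _ = ∑ i, (Real.sqrt (a i) * Q.mulVec v i) / N := by
              refine Finset.sum_congr rfl fun i _ => ?_
              rw [← Real.mul_self_sqrt (hap i).le, mul_assoc,
                Real.mul_self_sqrt (hap i).le, hf, mul_div_assoc]
          _ = 0 := by
              rw [← Finset.sum_div, sum_sqrt_mul_mulVec p a b hbp (fun _ => rfl) Q hp, hv0,
                zero_div]
      · calc _ = ∑ j, (v j * Real.sqrt (b j)) / n := by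
              refine Finset.sum_congr rfl fun j _ => ?_
              rw [← Real.mul_self_sqrt (hbp j).le, mul_assoc,
                Real.mul_self_sqrt (hbp j).le, hg]
              ring
          _ = 0 := by rw [← Finset.sum_div, hv0, zero_div]
      · simp only [← hasq, hf]
        simp only [div_pow]
        rw [← Finset.sum_div, ← hNsq, div_self (pow_pos hNpos 2).ne']
      · simp only [← hbsq, hg]
        simp only [div_pow]
        rw [← Finset.sum_div, ← hnsq, div_self (pow_pos hnpos 2).ne']
      · rw [sum_mul_eq_sum_mul_mulVec p a b Q hp]
        simp only [hf, hg]
        have hsmul : (fun j => v j / n) = n⁻¹ • v := by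
          ext j
          simp [div_eq_inv_mul]
        rw [hsmul, Matrix.mulVec_smul]
        calc N / n = N ^ 2 / (N * n) := by field_simp
          _ = _ := by
            rw [hNsq, Finset.sum_div]
            refine Finset.sum_congr rfl fun i _ => ?_
            simp only [Pi.smul_apply, smul_eq_mul]
            field_simp
    exact (le_div_self hNpos.le hnpos hn1).trans (le_csSup hSb hmem)
end

section
/- Let c ≥ 1 and let h : ℝ^p → ℝ and φ, ψ : ℝ^p → ℝ^c be differentiable with φ_i(θ) > 0 for all i and θ. Define f(θ, w) := h(θ) − Σ_{i=1}^c w_i² φ_i(θ) + Σ_{i=1}^c w_i ψ_i(θ) and g(θ) := max_{w ∈ ℝ^c} f(θ, w). Assume g has L-Lipschitz gradient (L > 0) and is bounded below by g* ∈ ℝ. Consider the iterates of the max-then-gradient algorithm: w^{t+1}_i = ψ_i(θ^t)/(2 φ_i(θ^t)) and θ^{t+1} = θ^t − (1/L) ∇_θ f(θ^t, w^{t+1}). Then for every T ≥ 1, min_{0 ≤ t < T} ‖∇g(θ^t)‖² ≤ 2L (g(θ⁰) − g*) / T; hence for any ε > 0 the algorithm reaches an iterate with ‖∇g(θ^t)‖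 ≤ ε within ⌈2L (g(θ⁰) − g*)/ε²⌉ iterations. -/
open InnerProductSpace Finset

section GradientDescent

variable {E : Type*} [NormedAddCommGroup E] [InnerProductSpace ℝ E] [CompleteSpace E]

/-- The quadratic upper bound for a function with `L`-Lipschitz gradient. -/
theorem le_add_inner_gradient_add_sq {g : E → ℝ} {L : ℝ} (hg : Differentiable ℝ g)
    (hlip : ∀ x y, ‖gradient g x - gradient g y‖ ≤ L * ‖x - y‖) (x d : E) :
    g (x + d) ≤ g x + inner ℝ (gradient g x) d + L / 2 * ‖d‖ ^ 2 := by
  have hderiv : ∀ s : ℝ, HasDerivAt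
      (fun s : ℝ => g (x + s • d) - s * inner ℝ (gradient g x) d - L / 2 * ‖d‖ ^ 2 * s ^ 2)
      (inner ℝ (gradient g (x + s • d)) d - inner ℝ (gradient g x) d - L * ‖d‖ ^ 2 * s) s := by
    intro s
    have hline : HasDerivAt (fun s : ℝ => x + s • d) d s := by
      simpa using ((hasDerivAt_id s).smul_const d).const_add x
    have hcomp := (hg (x + s • d)).hasGradientAt.hasFDerivAt.comp_hasDerivAt s hline
    rw [toDual_apply_apply] at hcomp
    have hlin := (hasDerivAt_id s).mul_const (inner ℝ (gradient g x) d)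
    have hquad := ((hasDerivAt_id s).pow 2).const_mul (L / 2 * ‖d‖ ^ 2)
    refine ((hcomp.sub hlin).sub hquad).congr_deriv ?_
    simp only [id]
    push_cast
    ring
  have hanti : AntitoneOn
      (fun s : ℝ => g (x + s • d) - s * inner ℝ (gradient g x) d - L / 2 * ‖d‖ ^ 2 * s ^ 2)
      (Set.Icc 0 1) := by
    refine antitoneOn_of_deriv_nonpos (convex_Icc 0 1)
      (fun s _ => (hderiv s).continuousAt.continuousWithinAt)
      (fun s _ => (hderiv s).differentiableAt.differentiableWithinAt) fun s hs => ?_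
    rw [interior_Icc] at hs
    rw [(hderiv s).deriv, ← inner_sub_left, sub_nonpos]
    calc inner ℝ (gradient g (x + s • d) - gradient g x) d
        ≤ ‖gradient g (x + s • d) - gradient g x‖ * ‖d‖ := real_inner_le_norm _ _
      _ ≤ L * ‖x + s • d - x‖ * ‖d‖ := by gcongr; exact hlip _ _
      _ = L * ‖d‖ ^ 2 * s := by
        rw [add_sub_cancel_left, norm_smul, Real.norm_of_nonneg hs.1.le]
        ring
  have h01 := hanti (Set.left_mem_Icc.2 zero_le_one) (Set.right_mem_Icc.2 zero_le_one) zero_le_one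
  simp only [one_smul, zero_smul, add_zero] at h01
  linarith

/-- One gradient step of length `1 / L` decreases `g` by at least `‖∇g‖² / (2L)`. -/
theorem sq_norm_gradient_le_of_gradient_step {g : E → ℝ} {L : ℝ} (hL : 0 < L)
    (hg : Differentiable ℝ g)
    (hlip : ∀ x y, ‖gradient g x - gradient g y‖ ≤ L * ‖x - y‖) (x : E) :
    ‖gradient g x‖ ^ 2 ≤ 2 * L * (g x - g (x - (1 / L) • gradient g x)) := by
  have hdesc := le_add_inner_gradient_add_sq hg hlip x (-((1 / L) • gradient g x))
  rw [← sub_eq_add_neg, inner_neg_right, inner_smul_right, real_inner_self_eq_norm_sq, norm_neg,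
    norm_smul, Real.norm_of_nonneg (by positivity)] at hdesc
  have hrhs : g x + -(1 / L * ‖gradient g x‖ ^ 2) + L / 2 * (1 / L * ‖gradient g x‖) ^ 2
      = g x - ‖gradient g x‖ ^ 2 / (2 * L) := by
    field_simp
    ring
  rw [hrhs] at hdesc
  have hdiv : ‖gradient g x‖ ^ 2 / (2 * L) ≤ g x - g (x - (1 / L) • gradient g x) := by linarith
  rw [div_le_iff₀ (by positivity)] at hdiv
  linarith

/-- The best of the first `T` gradient-descent iterates is stationary at rate `1 / T`. -/
theorem exists_sq_norm_gradient_le_div {g : E → ℝ} {L gstar : ℝ} (hL : 0 < L)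
    (hg : Differentiable ℝ g)
    (hlip : ∀ x y, ‖gradient g x - gradient g y‖ ≤ L * ‖x - y‖) (hbdd : ∀ x, gstar ≤ g x)
    {θ : ℕ → E} (hθ : ∀ t, θ (t + 1) = θ t - (1 / L) • gradient g (θ t)) {T : ℕ} (hT : 1 ≤ T) :
    ∃ t < T, ‖gradient g (θ t)‖ ^ 2 ≤ 2 * L * (g (θ 0) - gstar) / T := by
  have hT' : (0 : ℝ) < T := by exact_mod_cast hT
  have hsum : ∑ t ∈ range T, ‖gradient g (θ t)‖ ^ 2
      ≤ ∑ _t ∈ range T, 2 * L * (g (θ 0) - gstar) / T := by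
    calc ∑ t ∈ range T, ‖gradient g (θ t)‖ ^ 2
        ≤ ∑ t ∈ range T, 2 * L * (g (θ t) - g (θ (t + 1))) := by
          refine sum_le_sum fun t _ => ?_
          rw [hθ t]
          exact sq_norm_gradient_le_of_gradient_step hL hg hlip (θ t)
      _ = 2 * L * (g (θ 0) - g (θ T)) := by
          rw [← mul_sum, sum_range_sub' fun t => g (θ t)]
      _ ≤ 2 * L * (g (θ 0) - gstar) := by
          gcongr
          exact hbdd _
      _ = ∑ _t ∈ range T, 2 * L * (g (θ 0) - gstar) / T := by
          rw [sum_const, card_range, nsmul_eq_mul]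
          field_simp
  obtain ⟨t, ht, hle⟩ := exists_le_of_sum_le (nonempty_range_iff.2 (by omega)) hsum
  exact ⟨t, mem_range.1 ht, hle⟩

/-- A differentiable function that touches a differentiable majorant has the same gradient
there. -/
theorem gradient_eq_of_le_of_eq {f g : E → ℝ} {x : E} (hf : DifferentiableAt ℝ f x)
    (hg : DifferentiableAt ℝ g x) (hle : ∀ y, f y ≤ g y) (heq : f x = g x) :
    gradient f x = gradient g x := by
  have hmin : IsLocalMin (fun y => g y - f y) x :=
    Filter.Eventually.of_forall fun y => by
      simpa [heq] using hle y
  have hzero := hmin.hasFDerivAt_eq_zero (hg.hasFDerivAt.sub hf.hasFDerivAt)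
  rw [gradient, gradient, sub_eq_zero.1 hzero]

end GradientDescent

/-- The maximum of a concave quadratic in one variable is attained at its vertex. -/
theorem neg_sq_mul_add_mul_le_vertex {a : ℝ} (ha : 0 < a) (b v : ℝ) :
    -(v ^ 2 * a) + v * b ≤ -((b / (2 * a)) ^ 2 * a) + b / (2 * a) * b := by
  have hgap : -((b / (2 * a)) ^ 2 * a) + b / (2 * a) * b - (-(v ^ 2 * a) + v * b)
      = a * (v - b / (2 * a)) ^ 2 := by
    field_simp
    ring
  have : 0 ≤ a * (v - b / (2 * a)) ^ 2 := by positivity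
  linarith

/-- A separable concave quadratic is maximized coordinatewise. -/
theorem separable_quadratic_le_vertex {ι : Type*} [Fintype ι] {a : ι → ℝ} (ha : ∀ i, 0 < a i)
    (b v : ι → ℝ) (k : ℝ) :
    k - ∑ i, v i ^ 2 * a i + ∑ i, v i * b i
      ≤ k - ∑ i, (b i / (2 * a i)) ^ 2 * a i + ∑ i, b i / (2 * a i) * b i := by
  have hsum := sum_le_sum fun i (_ : i ∈ univ) => neg_sq_mul_add_mul_le_vertex (ha i) (b i) (v i)
  simp only [sum_add_distrib, sum_neg_distrib] at hsum
  linarith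

/-- Theorem 4 of the paper, made precise: the max-then-gradient algorithm
for the binary-sensitive-attribute Rényi fair classifier — inner maximization over the
adversarial vector solved in closed form `w^{t+1}ᵢ = ψᵢ(θᵗ)/(2φᵢ(θᵗ))`, followed by a
gradient step `θ^{t+1} = θᵗ − (1/L)∇_θ f(θᵗ, w^{t+1})` — reaches an `ε`-stationary point
of the value function `g(θ) = max_w f(θ,w)` at the `O(ε⁻²)` gradient-descent rate. -/
theorem renyi_fair_classifier_binary_rate
    (np c : ℕ) (hc : 1 ≤ c)
    (h : EuclideanSpace ℝ (Fin np) → ℝ)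
    (φ ψ : EuclideanSpace ℝ (Fin np) → (Fin c → ℝ))
    (hh : Differentiable ℝ h) (hφ : Differentiable ℝ φ) (hψ : Differentiable ℝ ψ)
    (hφpos : ∀ θ i, 0 < φ θ i)
    (f : EuclideanSpace ℝ (Fin np) → (Fin c → ℝ) → ℝ)
    (hf : ∀ θ w, f θ w = h θ - ∑ i, (w i) ^ 2 * φ θ i + ∑ i, w i * ψ θ i)
    (g : EuclideanSpace ℝ (Fin np) → ℝ)
    (hg : ∀ θ, g θ = sSup {r : ℝ | ∃ w : Fin c → ℝ, r = f θ w})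
    (L : ℝ) (hL : 0 < L)
    (hgdiff : Differentiable ℝ g)
    (hglip : ∀ x y, ‖gradient g x - gradient g y‖ ≤ L * ‖x - y‖)
    (gstar : ℝ) (hbdd : ∀ x, gstar ≤ g x)
    (θ : ℕ → EuclideanSpace ℝ (Fin np)) (w : ℕ → Fin c → ℝ)
    (hwiter : ∀ t i, w (t + 1) i = ψ (θ t) i / (2 * φ (θ t) i))
    (hθiter : ∀ t, θ (t + 1)
      = θ t - (1 / L) • gradient (fun θ' => f θ' (w (t + 1))) (θ t)) :
    (∀ T : ℕ, 1 ≤ T →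
      ∃ t < T, ‖gradient g (θ t)‖ ^ 2 ≤ 2 * L * (g (θ 0) - gstar) / T) ∧
    (∀ ε : ℝ, 0 < ε →
      ∃ t ≤ ⌈2 * L * (g (θ 0) - gstar) / ε ^ 2⌉₊, ‖gradient g (θ t)‖ ≤ ε) := by
  have hmax : ∀ x v, f x v ≤ f x fun i => ψ x i / (2 * φ x i) := fun x v => by
    rw [hf, hf]
    exact separable_quadratic_le_vertex (hφpos x) (ψ x) v (h x)
  have hlub : ∀ x, IsGreatest {r : ℝ | ∃ v : Fin c → ℝ, r = f x v}
      (f x fun i => ψ x i / (2 * φ x i)) := fun x =>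
    ⟨⟨_, rfl⟩, by rintro r ⟨v, rfl⟩; exact hmax x v⟩
  have hgval : ∀ x, g x = f x fun i => ψ x i / (2 * φ x i) := fun x => by
    rw [hg, (hlub x).csSup_eq]
  have hfdiff : ∀ v, Differentiable ℝ fun x => f x v := fun v => by
    have hφi := differentiable_pi.1 hφ
    have hψi := differentiable_pi.1 hψ
    simp only [hf]
    fun_prop
  have hgrad : ∀ t, gradient (fun x => f x (w (t + 1))) (θ t) = gradient g (θ t) := fun t => by
    refine gradient_eq_of_le_of_eq (hfdiff _ _) (hgdiff _) (fun y => ?_) ?_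
    · rw [hgval]
      exact hmax y _
    · rw [hgval, funext (hwiter t)]
  have hrate : ∀ T : ℕ, 1 ≤ T →
      ∃ t < T, ‖gradient g (θ t)‖ ^ 2 ≤ 2 * L * (g (θ 0) - gstar) / T := fun T hT =>
    exists_sq_norm_gradient_le_div hL hgdiff hglip hbdd
      (fun t => by rw [hθiter, hgrad]) hT
  refine ⟨hrate, fun ε hε => ?_⟩
  obtain ⟨t, ht, hle⟩ := hrate (⌈2 * L * (g (θ 0) - gstar) / ε ^ 2⌉₊ + 1) (by omega)
  refine ⟨t, by omega, (sq_le_sq₀ (norm_nonneg _) hε.le).1 ?_⟩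
  refine hle.trans ?_
  have hceil := Nat.le_ceil (2 * L * (g (θ 0) - gstar) / ε ^ 2)
  rw [div_le_iff₀ (by positivity)] at hceil
  rw [div_le_iff₀ (by positivity)]
  push_cast
  nlinarith [sq_nonneg ε]
end
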